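/- Let f₁, …, f_n : ℝ^d → ℝ be differentiable, convex, and each L-smooth, f(x) = (1/n)∑_{j=1}^n f_j(x); let h : ℝ^d → ℝ be σ-strongly convex with σ > 0, P = f + h, and x* a minimizer of P. Let ζ = d·λ²/(4(2^{b−1}−1)²) + d_λ(1−λ)² + 1/(NB) and suppose τ₂ = (5/3)ζ + 1/(2B) ≤ 1/2, m ≤ 3L/(2σ), τ₁ = √(mσ/(6L)), α = 1/(6τ₁L). On a probability space define random iterates with y₀ = z₀ = x̃⁰ = x₀ ∈ ℝ^d; for s = 0,…,S−1 and t = 0,…,m−1 with k = sm + t: x_{k+1} = τ₁z_k + τ₂x̃^s + (1 − τ₁ − τ₂)y_k; the random gradient estimates v_{k+1}, v̂_{k+1} satisfy, conditionally on all earlier iterates, E[v̂_{k+1}] = ∇f(x_{k+1}), E‖v̂_{k+1} − ∇f(x_{k+1})‖² ≤ (2L/B)·D_{k+1}, E‖v_{k+1} − ∇f(x_{k+1})‖² ≤ 4Lζ·D_{k+1}, and E‖v̂_{k+1} − v_{k+1}‖² ≤ 4L(ζ + 1/(2B))·D_{k+1}, where D_{k+1} = f(x̃^s) − f(x_{k+1})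 − ⟨∇f(x_{k+1}), x̃^s − x_{k+1}⟩; y_{k+1} is the minimizer of y ↦ 2L‖y − x_{k+1}‖² + ⟨v_{k+1}, y⟩ + h(y); z_{k+1} is the minimizer of z ↦ (1/(2α))‖z − z_k‖² + ⟨v̂_{k+1}, z⟩ + h(z); and x̃^{s+1} = (∑_{t=0}^{m−1}(1+ασ)^t)^{−1}·∑_{t=0}^{m−1}(1+ασ)^t·y_{sm+t+1}. Then there exists a constant C > 0, independent of S, such that E[P(x̃^S) − P(x*)] ≤ C·(1 + √(σ/(6Lm)))^{−Sm}·(P(x₀) − P(x*)). -/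

import Mathlib

open MeasureTheory ProbabilityTheory
open scoped ProbabilityTheory BigOperators RealInnerProductSpace

section det
variable {E : Type*} [NormedAddCommGroup E] [InnerProductSpace ℝ E]

lemma alpc_min_aux {p w B : ℝ} (H : ∀ t : ℝ, 0 < t → t ≤ 1 →
    p ≤ (1 - t) * p + t * w - (1 - t) * t * B) : p + B ≤ w := by
  have H' : ∀ t : ℝ, 0 < t → t ≤ 1 → (1 - t) * B ≤ w - p := by
    intro t h0 h1
    have := H t h0 h1
    have h2 : 0 ≤ t * ((w - p) - (1 - t) * B) := by nlinarith
    have := nonneg_of_mul_nonneg_right h2 h0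
    linarith
  by_contra hc
  push Not at hc
  have h1 := H' 1 one_pos le_rfl
  have hA : 0 ≤ w - p := by linarith
  have hB : 0 < B := by linarith
  have h3 := H' ((B - (w - p)) / (2 * B)) (by apply div_pos <;> linarith)
    (by rw [div_le_one (by linarith)]; linarith)
  have : (1 - (B - (w - p)) / (2 * B)) * B = (B + (w - p)) / 2 := by field_simp; ring
  linarith

lemma alpc_norm_comb (p w c : E) (t : ℝ) :
    ‖((1 - t) • p + t • w) - c‖ ^ 2 =
      (1 - t) * ‖p - c‖ ^ 2 + t * ‖w - c‖ ^ 2 - (1 - t) * t * ‖w - p‖ ^ 2 := by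
  have e1 : ((1 - t) • p + t • w) - c = (1 - t) • (p - c) + t • (w - c) := by module
  have e2 : w - p = (w - c) - (p - c) := by abel
  rw [e1, e2, norm_add_sq_real, norm_sub_sq_real (w - c) (p - c), norm_smul, norm_smul, inner_smul_left,
    inner_smul_right, mul_pow, mul_pow, Real.norm_eq_abs, Real.norm_eq_abs, sq_abs, sq_abs,
    real_inner_comm (w - c) (p - c)]
  simp only [conj_trivial]
  ring

lemma alpc_prox {h : E → ℝ} {σ a : ℝ} (hs : StrongConvexOn Set.univ σ h) {v c p : E}
    (hp : IsMinOn (fun z => a * ‖z - c‖ ^ 2 + ⟪v, z⟫ + h z) Set.univ p) (w : E) :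
    a * ‖p - c‖ ^ 2 + ⟪v, p⟫ + h p + (a + σ / 2) * ‖w - p‖ ^ 2 ≤
      a * ‖w - c‖ ^ 2 + ⟪v, w⟫ + h w := by
  apply alpc_min_aux
  intro t h0 h1
  have hm := isMinOn_iff.1 hp ((1 - t) • p + t • w) (Set.mem_univ _)
  have hh := hs.2 (Set.mem_univ p) (Set.mem_univ w) (sub_nonneg.2 h1) h0.le (by ring)
  simp only [smul_eq_mul, alpc_norm_comb, inner_add_right, inner_smul_right] at hm hh
  rw [norm_sub_rev p w] at hh
  nlinarith

lemma alpc_strong_min {F h : E → ℝ} {σ : ℝ} (hF : ConvexOn ℝ Set.univ F)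
    (hs : StrongConvexOn Set.univ σ h) {p : E} (hp : ∀ y, F p + h p ≤ F y + h y) (w : E) :
    F p + h p + σ / 2 * ‖w - p‖ ^ 2 ≤ F w + h w := by
  apply alpc_min_aux
  intro t h0 h1
  have hm := hp ((1 - t) • p + t • w)
  have hh := hs.2 (Set.mem_univ p) (Set.mem_univ w) (sub_nonneg.2 h1) h0.le (by ring)
  have hf := hF.2 (Set.mem_univ p) (Set.mem_univ w) (sub_nonneg.2 h1) h0.le (by ring)
  simp only [smul_eq_mul] at hh hf
  rw [norm_sub_rev p w] at hh
  nlinarith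

variable [CompleteSpace E]

lemma alpc_line_deriv {F : E → ℝ} {gF : E → E} (hg : ∀ x, HasGradientAt F (gF x) x)
    (x e : E) (t : ℝ) : HasDerivAt (fun s : ℝ => F (x + s • e)) ⟪gF (x + t • e), e⟫ t := by
  have h1 : HasDerivAt (fun s : ℝ => x + s • e) e t := by
    simpa using ((hasDerivAt_id t).smul_const e).const_add x
  have := (hg (x + t • e)).hasFDerivAt.comp_hasDerivAt t h1
  simp at this
  exact this

lemma alpc_grad_ineq {F : E → ℝ} {gF : E → E} (hg : ∀ x, HasGradientAt F (gF x) x)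
    (hF : ConvexOn ℝ Set.univ F) (x y : E) : F x + ⟪gF x, y - x⟫ ≤ F y := by
  have hc : ConvexOn ℝ Set.univ (fun s : ℝ => F (x + s • (y - x))) := by
    have := hF.comp_affineMap (AffineMap.lineMap x y : ℝ →ᵃ[ℝ] E)
    refine (this.congr ?_)
    intro s _
    simp [AffineMap.lineMap_apply, add_comm]
  have := hc.le_slope_of_hasDerivAt (Set.mem_univ 0) (Set.mem_univ 1) one_pos
    (alpc_line_deriv hg x (y - x) 0)
  simp [slope_def_field] at this
  linarith

lemma alpc_descent {F : E → ℝ} {gF : E → E} (hg : ∀ x, HasGradientAt F (gF x) x) {L : ℝ}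
    (hL : ∀ x y, ‖gF x - gF y‖ ≤ L * ‖x - y‖) (x y : E) :
    F y ≤ F x + ⟪gF x, y - x⟫ + L / 2 * ‖y - x‖ ^ 2 := by
  have hd : ∀ t : ℝ, HasDerivAt (fun s : ℝ => F (x + s • (y - x)) - s * ⟪gF x, y - x⟫
      - s ^ 2 * (L / 2 * ‖y - x‖ ^ 2))
      (⟪gF (x + t • (y - x)), y - x⟫ - ⟪gF x, y - x⟫ - 2 * t * (L / 2 * ‖y - x‖ ^ 2)) t := by
    intro t
    have h2 := ((hasDerivAt_id t).mul_const ⟪gF x, y - x⟫)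
    have h3 := ((hasDerivAt_pow 2 t).mul_const (L / 2 * ‖y - x‖ ^ 2))
    have := ((alpc_line_deriv hg x (y - x) t).sub h2).sub h3
    simp at this
    exact this
  have ha : AntitoneOn (fun s : ℝ => F (x + s • (y - x)) - s * ⟪gF x, y - x⟫
      - s ^ 2 * (L / 2 * ‖y - x‖ ^ 2)) (Set.Icc 0 1) := by
    apply antitoneOn_of_deriv_nonpos (convex_Icc 0 1)
    · exact fun t _ => (hd t).continuousAt.continuousWithinAt
    · exact fun t _ => (hd t).differentiableAt.differentiableWithinAt
    · intro t ht
      rw [interior_Icc] at ht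
      rw [(hd t).deriv, ← inner_sub_left]
      have h1 := real_inner_le_norm (gF (x + t • (y - x)) - gF x) (y - x)
      have h2 := hL (x + t • (y - x)) x
      rw [add_sub_cancel_left, norm_smul, Real.norm_of_nonneg ht.1.le] at h2
      have h3 := mul_le_mul_of_nonneg_right h2 (norm_nonneg (y - x))
      nlinarith
  have := ha (Set.left_mem_Icc.2 zero_le_one) (Set.right_mem_Icc.2 zero_le_one) zero_le_one
  simp at this
  linarith

lemma alpc_young (a b : E) {c : ℝ} (hc : 0 < c) :
    ⟪a, b⟫ ≤ 1 / (4 * c) * ‖a‖ ^ 2 + c * ‖b‖ ^ 2 := by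
  have h1 := real_inner_le_norm a b
  have h2 : 1 / (4 * c) * ‖a‖ ^ 2 + c * ‖b‖ ^ 2 - ‖a‖ * ‖b‖
      = 1 / (4 * c) * (‖a‖ - 2 * c * ‖b‖) ^ 2 := by field_simp; ring
  have h3 : 0 ≤ 1 / (4 * c) * (‖a‖ - 2 * c * ‖b‖) ^ 2 := by positivity
  linarith

lemma alpc_step {F h : E → ℝ} {gF : E → E} {L σ τ₁ τ₂ α : ℝ} (hL : 0 < L) (hτ₁ : 0 < τ₁)
    (hτ₂ : 0 ≤ τ₂) (hτ : τ₁ + τ₂ ≤ 1) (hα : α = 1 / (6 * τ₁ * L)) (hσ : 0 < σ)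
    (hg : ∀ x, HasGradientAt F (gF x) x)
    (hsm : ∀ x y, ‖gF x - gF y‖ ≤ L * ‖x - y‖)
    (hF : ConvexOn ℝ Set.univ F) (hs : StrongConvexOn Set.univ σ h)
    {x y z xt v vh yp zp : E} (u : E)
    (hx : x = τ₁ • z + τ₂ • xt + (1 - τ₁ - τ₂) • y)
    (hy : IsMinOn (fun y' => 2 * L * ‖y' - x‖ ^ 2 + ⟪v, y'⟫ + h y') Set.univ yp)
    (hz : IsMinOn (fun z' => (1 / (2 * α)) * ‖z' - z‖ ^ 2 + ⟪vh, z'⟫ + h z') Set.univ zp) :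
    F yp + h yp ≤ τ₁ * (F u + h u) + τ₂ * (F xt + h xt) + (1 - τ₁ - τ₂) * (F y + h y)
      + 1 / (6 * L) * ‖v - gF x‖ ^ 2 + 1 / (4 * L) * ‖vh - v‖ ^ 2
      - τ₂ * (F xt - F x - ⟪gF x, xt - x⟫) + τ₁ * ⟪u - z, vh - gF x⟫
      + 3 * τ₁ ^ 2 * L * ‖z - u‖ ^ 2 - 3 * τ₁ ^ 2 * L * (1 + α * σ) * ‖zp - u‖ ^ 2 := by
  have hcnn : 0 ≤ 1 - τ₁ - τ₂ := by linarith
  have hconv : ConvexOn ℝ Set.univ h := by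
    have := hs.mono hσ.le
    simpa using this
  -- smoothness
  have d1 := alpc_descent hg hsm x yp
  set w : E := τ₁ • zp + τ₂ • xt + (1 - τ₁ - τ₂) • y with hw
  have hwx : w - x = τ₁ • (zp - z) := by rw [hw, hx]; module
  have d2 := isMinOn_iff.1 hy w (Set.mem_univ _)
  have d3 := alpc_young (gF x - v) (yp - x) (c := 3 * L / 2) (by positivity)
  have d4 := alpc_young (v - vh) (τ₁ • (zp - z)) hL
  have d5 : h w ≤ τ₁ * h zp + τ₂ * h xt + (1 - τ₁ - τ₂) * h y := by
    have := hconv.map_sum_le (t := Finset.univ) (w := ![τ₁, τ₂, 1 - τ₁ - τ₂]) (p := ![zp, xt, y])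
      (by intro i _; fin_cases i <;> simp <;> linarith) (by simp [Fin.sum_univ_three])
      (by simp)
    simpa [Fin.sum_univ_three, hw] using this
  have d6 := alpc_prox hs hz u
  have d7 := alpc_grad_ineq hg hF x u
  have d8 := alpc_grad_ineq hg hF x y
  have hαe : 1 / (2 * α) = 3 * τ₁ * L := by rw [hα]; field_simp; norm_num
  have hασ : 3 * τ₁ ^ 2 * L * (α * σ) = τ₁ * σ / 2 := by rw [hα]; field_simp; norm_num
  have hzx : τ₁ * ⟪gF x, u - z⟫ = τ₁ * ⟪gF x, u - x⟫ + τ₂ * ⟪gF x, xt - x⟫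
      + (1 - τ₁ - τ₂) * ⟪gF x, y - x⟫ := by
    simp only [← inner_smul_right, ← inner_add_right]
    congr 1
    have : τ₁ • (u - z) = τ₁ • (u - x) + τ₂ • (xt - x) + (1 - τ₁ - τ₂) • (y - x)
        + (x - (τ₁ • z + τ₂ • xt + (1 - τ₁ - τ₂) • y)) := by module
    rw [this, ← hx, sub_self, add_zero]
  rw [hαe, norm_sub_rev u zp, norm_sub_rev u z] at d6
  rw [norm_sub_rev (gF x) v] at d3
  rw [norm_sub_rev v vh] at d4
  have hvw : ⟪v, w⟫ = ⟪v, x⟫ + ⟪v, τ₁ • (zp - z)⟫ := by rw [← hwx, inner_sub_right]; ring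
  rw [hwx, hvw] at d2
  have hn : ‖τ₁ • (zp - z)‖ ^ 2 = τ₁ ^ 2 * ‖zp - z‖ ^ 2 := by
    rw [norm_smul, mul_pow, Real.norm_eq_abs, sq_abs]
  rw [hn] at d2 d4
  have hin : ⟪u - z, vh - gF x⟫ = ⟪vh, u - z⟫ - ⟪gF x, u - z⟫ := by
    rw [real_inner_comm, inner_sub_left]
  rw [hin]
  simp only [inner_sub_left, inner_sub_right, inner_smul_right] at *
  have e6 := mul_le_mul_of_nonneg_left d6 hτ₁.le
  have e7 := mul_le_mul_of_nonneg_left d7 hτ₁.le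
  have e8 := mul_le_mul_of_nonneg_left d8 hcnn
  have q1 : 1 / (4 * (3 * L / 2)) = 1 / (6 * L) := by field_simp; norm_num
  rw [q1] at d3
  have q2 : 3 * τ₁ ^ 2 * L * (1 + α * σ) * ‖zp - u‖ ^ 2 =
    3 * τ₁ ^ 2 * L * ‖zp - u‖ ^ 2 + τ₁ * σ / 2 * ‖zp - u‖ ^ 2 := by rw [← hασ]; ring
  rw [q2]
  linarith
end det

lemma alpc_geom {e τ₂ : ℝ} {m : ℕ} (hm : 0 < m) (he : 0 < e) (hme : m * e ≤ 1 / 2)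
    (h0 : 0 ≤ τ₂) (hτ : τ₂ ≤ 1 / 2) :
    τ₂ * (1 + e) ^ m ≤ 1 - (1 - m * e - τ₂) * (1 + e) := by
  obtain ⟨j, rfl⟩ : ∃ j, m = j + 1 := ⟨m - 1, by omega⟩
  push_cast at *
  have hj : (0 : ℝ) ≤ j := Nat.cast_nonneg j
  have hje : (j : ℝ) * e ≤ 1 / 2 := by nlinarith
  have hje0 : 0 ≤ (j : ℝ) * e := by positivity
  have h1 : (1 + e) ^ j ≤ 1 + j * e + (j * e) ^ 2 := by
    have a1 : (1 + e) ^ j ≤ Real.exp (j * e) := by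
      rw [Real.exp_nat_mul]
      exact pow_le_pow_left₀ (by positivity) (by linarith [Real.add_one_le_exp e]) _
    have a2 := Real.abs_exp_sub_one_sub_id_le (x := j * e) (by rw [abs_of_nonneg hje0]; linarith)
    have := (abs_le.1 a2).2
    linarith
  have h2 : (1 : ℝ) ≤ (1 + e) ^ j := one_le_pow₀ (by linarith)
  have h3 : (1 + e) ^ j - 1 ≤ 3 / 2 * (j * e) := by nlinarith
  have h4 : τ₂ * ((1 + e) ^ j - 1) * (1 + e) ≤ 1 / 2 * (3 / 2 * (j * e)) * (1 + e) := by
    gcongr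
  rw [pow_succ]
  nlinarith [mul_nonneg hje0 he.le]

lemma alpc_epoch {a c : ℕ → ℝ} {b q β τ : ℝ} {m k : ℕ} (hq : 0 ≤ q)
    (H : ∀ t < m, a (k + t + 1) ≤ τ * b + β * a (k + t) + c (k + t) - q * c (k + t + 1)) :
    ∀ r ≤ m, (1 - β * q) * ∑ t ∈ Finset.range r, q ^ t * a (k + t + 1) + β * q ^ r * a (k + r)
      + q ^ r * c (k + r) ≤ τ * b * ∑ t ∈ Finset.range r, q ^ t + β * a k + c k := by
  intro r
  induction r with
  | zero => intro _; simp
  | succ r ih =>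
    intro hr
    have h1 := ih (by omega)
    have h2 := mul_le_mul_of_nonneg_left (H r (by omega)) (pow_nonneg hq r)
    rw [Finset.sum_range_succ, Finset.sum_range_succ, ← add_assoc, pow_succ]
    linarith

lemma alpc_rec {a b c : ℕ → ℝ} {q β τ : ℝ} {m : ℕ} (hq : 0 < q)
    (ha : ∀ k, 0 ≤ a k)
    (hτq : τ * q ^ m ≤ 1 - β * q) (hτ : 0 ≤ τ)
    (H : ∀ s, ∀ t < m, a (s * m + t + 1) ≤ τ * b s + β * a (s * m + t) + c (s * m + t)
      - q * c (s * m + t + 1))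
    (hb : ∀ s, (∑ t ∈ Finset.range m, q ^ t) * b (s + 1) ≤
      ∑ t ∈ Finset.range m, q ^ t * a (s * m + t + 1)) (S : ℕ) :
    q ^ (S * m) * (τ * (∑ t ∈ Finset.range m, q ^ t) * b S + β * a (S * m) + c (S * m)) ≤
      τ * (∑ t ∈ Finset.range m, q ^ t) * b 0 + β * a 0 + c 0 := by
  induction S with
  | zero => simp
  | succ s ih =>
    refine le_trans ?_ ih
    rw [Nat.succ_mul, pow_add, mul_assoc]
    apply mul_le_mul_of_nonneg_left _ (by positivity)
    have h1 := alpc_epoch hq.le (H s) m le_rfl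
    have hS : 0 ≤ ∑ t ∈ Finset.range m, q ^ t * a (s * m + t + 1) :=
      Finset.sum_nonneg fun t _ => mul_nonneg (by positivity) (ha _)
    have h2 := mul_le_mul_of_nonneg_right hτq hS
    have h3 := mul_le_mul_of_nonneg_left (hb s) (mul_nonneg hτ (pow_nonneg hq.le m))
    linarith

lemma alpc_cross {Ω : Type*} {m0 mΩ : MeasurableSpace Ω} {μ : Measure Ω}
    [IsProbabilityMeasure μ]
    {E : Type*} [NormedAddCommGroup E] [InnerProductSpace ℝ E] [CompleteSpace E]
    (hm : m0 ≤ mΩ) {w V G : Ω → E}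
    (hw : StronglyMeasurable[m0] w) (hV : Integrable V μ) (hG : μ[V | m0] =ᵐ[μ] G)
    (hw2 : Integrable (fun ω => ‖w ω‖ ^ 2) μ) (hV2 : Integrable (fun ω => ‖V ω - G ω‖ ^ 2) μ) :
    Integrable (fun ω => ⟪w ω, V ω - G ω⟫) μ ∧ ∫ ω, ⟪w ω, V ω - G ω⟫ ∂μ = 0 := by
  have hGi : Integrable G μ := integrable_condExp.congr hG
  have hd : Integrable (fun ω => V ω - G ω) μ := hV.sub hGi
  have hwa : AEStronglyMeasurable w μ := (hw.mono hm).aestronglyMeasurable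
  have hI : Integrable (fun ω => ⟪w ω, V ω - G ω⟫) μ := by
    refine (hw2.add hV2).mono (hwa.inner hd.aestronglyMeasurable) (Filter.Eventually.of_forall ?_)
    intro ω
    have h1 := abs_real_inner_le_norm (w ω) (V ω - G ω)
    simp only [Pi.add_apply, Real.norm_eq_abs]
    rw [abs_of_nonneg (a := ‖w ω‖ ^ 2 + _) (by positivity)]
    nlinarith [sq_nonneg (‖w ω‖ - ‖V ω - G ω‖), norm_nonneg (w ω), norm_nonneg (V ω - G ω)]
  refine ⟨hI, ?_⟩
  have h0 : μ[fun ω => V ω - G ω | m0] =ᵐ[μ] 0 := by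
    have e1 : μ[G | m0] =ᵐ[μ] G := by
      refine (condExp_congr_ae hG.symm).trans ?_
      rw [condExp_of_stronglyMeasurable hm stronglyMeasurable_condExp integrable_condExp]
      exact hG
    have e2 := condExp_sub hV hGi m0
    filter_upwards [e1, e2, hG] with ω a1 a2 a3
    have : (μ[fun ω => V ω - G ω | m0]) ω = (μ[V - G | m0]) ω := rfl
    rw [this, a2]
    simp [a1, a3]
  have hp := condExp_bilin_of_stronglyMeasurable_left (innerSL ℝ) hw
    (g := fun ω => V ω - G ω) hI hd
  have : ∫ ω, ⟪w ω, V ω - G ω⟫ ∂μ = ∫ ω, (μ[fun ω => ⟪w ω, V ω - G ω⟫ | m0]) ω ∂μ :=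
    (integral_condExp hm).symm
  rw [this]
  apply integral_eq_zero_of_ae
  filter_upwards [hp, h0] with ω a1 a2
  refine a1.trans ?_
  rw [a2]
  simp

lemma alpc_condbound {Ω : Type*} {m0 mΩ : MeasurableSpace Ω} {μ : Measure Ω}
    [IsProbabilityMeasure μ] (hm : m0 ≤ mΩ) {X D : Ω → ℝ} {K : ℝ}
    (hD : Integrable D μ) (h : ∀ᵐ ω ∂μ, (μ[X | m0]) ω ≤ K * D ω) :
    ∫ ω, X ω ∂μ ≤ K * ∫ ω, D ω ∂μ := by
  rw [← integral_condExp hm, ← integral_const_mul]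
  exact integral_mono_ae integrable_condExp (hD.const_mul K) h

set_option maxHeartbeats 2000000 in
/-- **Linear convergence of ALPC-SVRG in the strongly convex case (Theorem 3).**
With `ζ = dλ²/(4(2^{b-1}-1)²) + d_λ(1-λ)² + 1/(NB)`, `τ₂ = (5/3)ζ + 1/(2B) ≤ 1/2`,
`m ≤ 3L/(2σ)`, `τ₁ = √(mσ/(6L))` and `α = 1/(6τ₁L)`, the accelerated low-precision iterates
whose stochastic gradient estimates `v` (quantized) and `v̂` (full-precision, double sampling)
satisfy the stated conditional second-moment bounds obey
`E[P(x̃^S) - P(x*)] ≤ C·(1 + √(σ/(6Lm)))^{-Sm}·(P(x₀) - P(x*))`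
for a constant `C > 0` independent of `S`. -/
theorem alpc_svrg_linear_convergence
    {Ω : Type*} [MeasureSpace Ω] [IsProbabilityMeasure (ℙ : Measure Ω)]
    {d n N B m : ℕ} (hn : 0 < n) (hN : 0 < N) (hB : 0 < B) (hm : 0 < m)
    (b dlam : ℕ) (hb : 2 ≤ b) (hdlam : dlam ≤ d)
    (lam : ℝ) (hlam : lam ∈ Set.Ioc (0 : ℝ) 1)
    (L : ℝ) (hL : 0 < L) (σ : ℝ) (hσ : 0 < σ)
    (f : Fin n → EuclideanSpace ℝ (Fin d) → ℝ)
    (g : Fin n → EuclideanSpace ℝ (Fin d) → EuclideanSpace ℝ (Fin d))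
    (hgrad : ∀ j x, HasGradientAt (f j) (g j x) x)
    (hconv : ∀ j, ConvexOn ℝ Set.univ (f j))
    (hsmooth : ∀ j x y, ‖g j x - g j y‖ ≤ L * ‖x - y‖)
    (F : EuclideanSpace ℝ (Fin d) → ℝ) (hF : ∀ y, F y = (n : ℝ)⁻¹ * ∑ j, f j y)
    (gF : EuclideanSpace ℝ (Fin d) → EuclideanSpace ℝ (Fin d))
    (hgF : ∀ x, HasGradientAt F (gF x) x)
    (h : EuclideanSpace ℝ (Fin d) → ℝ) (hstrong : StrongConvexOn Set.univ σ h)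
    (P : EuclideanSpace ℝ (Fin d) → ℝ) (hP : ∀ y, P y = F y + h y)
    (xstar : EuclideanSpace ℝ (Fin d)) (hstar : ∀ y, P xstar ≤ P y)
    -- parameters
    (ζ τ₁ τ₂ α : ℝ)
    (hζ : ζ = (d : ℝ) * lam ^ 2 / (4 * ((2 : ℝ) ^ (b - 1) - 1) ^ 2) +
      (dlam : ℝ) * (1 - lam) ^ 2 + 1 / ((N : ℝ) * (B : ℝ)))
    (hτ₂ : τ₂ = 5 / 3 * ζ + 1 / (2 * (B : ℝ))) (hτ₂le : τ₂ ≤ 1 / 2)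
    (hmσ : (m : ℝ) ≤ 3 * L / (2 * σ))
    (hτ₁ : τ₁ = Real.sqrt ((m : ℝ) * σ / (6 * L)))
    (hα : α = 1 / (6 * τ₁ * L))
    -- iterates
    (x0 : EuclideanSpace ℝ (Fin d))
    (x y z : ℕ → Ω → EuclideanSpace ℝ (Fin d))
    (xtil : ℕ → Ω → EuclideanSpace ℝ (Fin d))
    (v vh : ℕ → Ω → EuclideanSpace ℝ (Fin d))
    (hy0 : ∀ ω, y 0 ω = x0) (hz0 : ∀ ω, z 0 ω = x0) (hxtil0 : ∀ ω, xtil 0 ω = x0)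
    (hxcomb : ∀ s, ∀ t < m, ∀ ω,
      x (s * m + t + 1) ω =
        τ₁ • z (s * m + t) ω + τ₂ • xtil s ω + (1 - τ₁ - τ₂) • y (s * m + t) ω)
    (hyupdate : ∀ k ω, IsMinOn
      (fun y' => 2 * L * ‖y' - x (k + 1) ω‖ ^ 2 + ⟪v (k + 1) ω, y'⟫ + h y')
      Set.univ (y (k + 1) ω))
    (hzupdate : ∀ k ω, IsMinOn
      (fun z' => (1 / (2 * α)) * ‖z' - z k ω‖ ^ 2 + ⟪vh (k + 1) ω, z'⟫ + h z')
      Set.univ (z (k + 1) ω))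
    (hxtilsucc : ∀ s ω, xtil (s + 1) ω =
      (∑ t ∈ Finset.range m, (1 + α * σ) ^ t)⁻¹ •
        ∑ t ∈ Finset.range m, (1 + α * σ) ^ t • y (s * m + t + 1) ω)
    -- a filtration recording "all earlier iterates"
    (mfil : ℕ → MeasurableSpace Ω)
    (hle : ∀ k, mfil k ≤ (inferInstance : MeasurableSpace Ω)) (hmono : Monotone mfil)
    (hady : ∀ k, Measurable[mfil k] (y k)) (hadz : ∀ k, Measurable[mfil k] (z k))
    (hadxtil : ∀ s, Measurable[mfil (s * m)] (xtil s))
    (hadv : ∀ k, Measurable[mfil (k + 1)] (v (k + 1)))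
    (hadvh : ∀ k, Measurable[mfil (k + 1)] (vh (k + 1)))
    (hmeasv : ∀ k, Measurable (v k)) (hmeasvh : ∀ k, Measurable (vh k))
    (hmeasx : ∀ k, Measurable (x k)) (hmeasy : ∀ k, Measurable (y k))
    (hmeasz : ∀ k, Measurable (z k)) (hmeasxtil : ∀ s, Measurable (xtil s))
    -- integrability
    (hintPy : ∀ k, Integrable fun ω => P (y k ω))
    (hintz : ∀ k, Integrable fun ω => ‖z k ω‖ ^ 2)
    (hintPxtil : ∀ s, Integrable fun ω => P (xtil s ω))
    (hintPx : ∀ k, Integrable fun ω => P (x (k + 1) ω))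
    (hintvh : ∀ k, Integrable (vh (k + 1)))
    (hintvhvar : ∀ k, Integrable fun ω => ‖vh (k + 1) ω - gF (x (k + 1) ω)‖ ^ 2)
    (hintvvar : ∀ k, Integrable fun ω => ‖v (k + 1) ω - gF (x (k + 1) ω)‖ ^ 2)
    (hintdiff : ∀ k, Integrable fun ω => ‖vh (k + 1) ω - v (k + 1) ω‖ ^ 2)
    (hintD : ∀ s, ∀ t < m, Integrable fun ω =>
      F (xtil s ω) - F (x (s * m + t + 1) ω) -
        ⟪gF (x (s * m + t + 1) ω), xtil s ω - x (s * m + t + 1) ω⟫)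
    -- conditional second-moment bounds on the two gradient estimators
    (hvhmean : ∀ s, ∀ t < m,
      (ℙ[vh (s * m + t + 1) | mfil (s * m + t)]) =ᵐ[ℙ]
        fun ω => gF (x (s * m + t + 1) ω))
    (hvhvar : ∀ s, ∀ t < m, ∀ᵐ ω ∂ℙ,
      (ℙ[fun ω' => ‖vh (s * m + t + 1) ω' - gF (x (s * m + t + 1) ω')‖ ^ 2 |
          mfil (s * m + t)]) ω ≤
        (2 * L / (B : ℝ)) *
          (F (xtil s ω) - F (x (s * m + t + 1) ω) -
            ⟪gF (x (s * m + t + 1) ω), xtil s ω - x (s * m + t + 1) ω⟫))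
    (hvvar : ∀ s, ∀ t < m, ∀ᵐ ω ∂ℙ,
      (ℙ[fun ω' => ‖v (s * m + t + 1) ω' - gF (x (s * m + t + 1) ω')‖ ^ 2 |
          mfil (s * m + t)]) ω ≤
        4 * L * ζ *
          (F (xtil s ω) - F (x (s * m + t + 1) ω) -
            ⟪gF (x (s * m + t + 1) ω), xtil s ω - x (s * m + t + 1) ω⟫))
    (hdiffvar : ∀ s, ∀ t < m, ∀ᵐ ω ∂ℙ,
      (ℙ[fun ω' => ‖vh (s * m + t + 1) ω' - v (s * m + t + 1) ω'‖ ^ 2 |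
          mfil (s * m + t)]) ω ≤
        4 * L * (ζ + 1 / (2 * (B : ℝ))) *
          (F (xtil s ω) - F (x (s * m + t + 1) ω) -
            ⟪gF (x (s * m + t + 1) ω), xtil s ω - x (s * m + t + 1) ω⟫)) :
    ∃ C : ℝ, 0 < C ∧ ∀ S : ℕ,
      (∫ ω, P (xtil S ω)) - P xstar ≤
        C * ((1 + Real.sqrt (σ / (6 * L * (m : ℝ)))) ^ (S * m))⁻¹ * (P x0 - P xstar) := by
  classical
  have hmR : (0 : ℝ) < m := by exact_mod_cast hm
  have hnR : (0 : ℝ) < n := by exact_mod_cast hn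
  have hBR : (0 : ℝ) < B := by exact_mod_cast hB
  have hNR : (0 : ℝ) < N := by exact_mod_cast hN
  -- parameters
  have hζpos : 0 < ζ := by
    rw [hζ]
    have h1 : 0 ≤ (d : ℝ) * lam ^ 2 / (4 * ((2 : ℝ) ^ (b - 1) - 1) ^ 2) := by positivity
    have h2 : 0 ≤ (dlam : ℝ) * (1 - lam) ^ 2 := by positivity
    have h3 : 0 < 1 / ((N : ℝ) * (B : ℝ)) := by positivity
    linarith
  have hτ₂pos : 0 < τ₂ := by rw [hτ₂]; positivity
  have hτ₁pos : 0 < τ₁ := by rw [hτ₁]; positivity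
  have hτ₁sq : τ₁ ^ 2 = m * σ / (6 * L) := by rw [hτ₁, Real.sq_sqrt (by positivity)]
  have hτ₁le : τ₁ ≤ 1 / 2 := by
    have h1 : (m : ℝ) * σ / (6 * L) ≤ (1 / 2) ^ 2 := by
      rw [le_div_iff₀ (by positivity)] at hmσ
      rw [div_le_iff₀ (by positivity)]
      linarith
    rw [← hτ₁sq] at h1
    exact (le_abs_self τ₁).trans (abs_le_of_sq_le_sq h1 (by norm_num))
  have hme : (m : ℝ) * (α * σ) = τ₁ := by
    rw [hα]
    have : (m : ℝ) * (1 / (6 * τ₁ * L) * σ) = (m * σ / (6 * L)) / τ₁ := by field_simp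
    rw [this, ← hτ₁sq]; field_simp
  have hepos : 0 < α * σ := by rw [hα]; positivity
  have hesqrt : Real.sqrt (σ / (6 * L * (m : ℝ))) = α * σ := by
    rw [Real.sqrt_eq_iff_mul_self_eq (by positivity) hepos.le]
    have : α * σ = τ₁ / m := by rw [← hme]; field_simp
    rw [this, div_mul_div_comm, ← sq, hτ₁sq]
    field_simp
  -- F is convex and smooth
  have hFconv : ConvexOn ℝ Set.univ F := by
    have h1 : ConvexOn ℝ Set.univ (fun y => ∑ j, f j y) :=
      ⟨convex_univ, fun u _ w _ p r hp hr hpr => by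
        simp only [smul_eq_mul, Finset.mul_sum, ← Finset.sum_add_distrib]
        exact Finset.sum_le_sum fun j _ =>
          (hconv j).2 (Set.mem_univ u) (Set.mem_univ w) hp hr hpr⟩
    have h2 := h1.smul (c := (n : ℝ)⁻¹) (by positivity)
    refine h2.congr fun y _ => ?_
    simp [hF]
  have hgFeq : ∀ x, gF x = (n : ℝ)⁻¹ • ∑ j, g j x := by
    intro x
    refine (hgF x).unique ?_
    have h1 : HasFDerivAt (fun y => (n : ℝ)⁻¹ • ∑ j, f j y)
        ((n : ℝ)⁻¹ • ∑ j, (InnerProductSpace.toDual ℝ _) (g j x)) x :=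
      (HasFDerivAt.fun_sum fun j _ => (hgrad j x).hasFDerivAt).fun_const_smul _
    rw [hasGradientAt_iff_hasFDerivAt]
    have h2 : F = fun y => (n : ℝ)⁻¹ • ∑ j, f j y := by ext y; simp [hF]
    have h3 : (InnerProductSpace.toDual ℝ (EuclideanSpace ℝ (Fin d))) ((n : ℝ)⁻¹ • ∑ j, g j x) =
        (n : ℝ)⁻¹ • ∑ j, (InnerProductSpace.toDual ℝ _) (g j x) := by
      simp [map_sum]
    rw [h2, h3]
    exact h1
  have hgFsm : ∀ x y, ‖gF x - gF y‖ ≤ L * ‖x - y‖ := by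
    intro x y
    rw [hgFeq, hgFeq, ← smul_sub, ← Finset.sum_sub_distrib, norm_smul, norm_inv,
      Real.norm_natCast]
    have h1 : ‖∑ j, (g j x - g j y)‖ ≤ ∑ _j : Fin n, L * ‖x - y‖ :=
      norm_sum_le_of_le _ fun j _ => hsmooth j x y
    rw [Finset.sum_const, Finset.card_univ, Fintype.card_fin, nsmul_eq_mul] at h1
    calc (n : ℝ)⁻¹ * ‖∑ j, (g j x - g j y)‖ ≤ (n : ℝ)⁻¹ * (n * (L * ‖x - y‖)) := by gcongr
      _ = L * ‖x - y‖ := by field_simp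
  have hhconv : ConvexOn ℝ Set.univ h := by
    have := hstrong.mono hσ.le
    simpa using this
  have hPconv : ConvexOn ℝ Set.univ P := by
    refine (hFconv.add hhconv).congr fun y _ => ?_
    simp [hP]
  -- sequences
  set q : ℝ := 1 + α * σ with hq
  have hqpos : 0 < q := by rw [hq]; linarith
  set Q : ℝ := ∑ t ∈ Finset.range m, q ^ t with hQ
  have hQpos : 0 < Q := by
    rw [hQ]
    exact Finset.sum_pos (fun t _ => by positivity) ⟨0, Finset.mem_range.2 hm⟩
  set κ : ℝ := 3 * τ₁ ^ 2 * L with hκ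
  have hκnn : 0 ≤ κ := by rw [hκ]; positivity
  let a : ℕ → ℝ := fun k => (∫ ω, P (y k ω)) - P xstar
  let bb : ℕ → ℝ := fun s => (∫ ω, P (xtil s ω)) - P xstar
  let c : ℕ → ℝ := fun k => κ * ∫ ω, ‖z k ω - xstar‖ ^ 2
  have hiz : ∀ k, Integrable fun ω => ‖z k ω - xstar‖ ^ 2 := by
    intro k
    refine (((hintz k).const_mul 2).add (integrable_const (2 * ‖xstar‖ ^ 2))).mono
      (((hmeasz k).sub_const xstar).norm.pow_const 2).aestronglyMeasurable
      (Filter.Eventually.of_forall fun ω => ?_)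
    simp only [Pi.add_apply, Real.norm_eq_abs]
    rw [abs_of_nonneg (by positivity), abs_of_nonneg (by positivity)]
    have h1 := norm_sub_le (z k ω) xstar
    have h2 := pow_le_pow_left₀ (norm_nonneg _) h1 2
    nlinarith [sq_nonneg (‖z k ω‖ - ‖xstar‖)]
  have hann : ∀ k, 0 ≤ a k := by
    intro k
    have h1 : ∫ _ω : Ω, P xstar ≤ ∫ ω, P (y k ω) :=
      integral_mono (integrable_const _) (hintPy k) fun ω => hstar _
    simp at h1
    simp only [a]; linarith
  have hcnn : ∀ k, 0 ≤ c k := fun k =>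
    mul_nonneg hκnn (integral_nonneg fun ω => by positivity)
  have hstep : ∀ s, ∀ t < m, a (s * m + t + 1) ≤ τ₂ * bb s + (1 - τ₁ - τ₂) * a (s * m + t)
      + c (s * m + t) - q * c (s * m + t + 1) := by
    intro s t ht
    set k := s * m + t with hk
    have hsk : mfil (s * m) ≤ mfil k := hmono (by omega)
    have hwm : StronglyMeasurable[mfil k] (fun ω => xstar - z k ω) :=
      stronglyMeasurable_const.sub (hadz k).stronglyMeasurable
    have hw2 : Integrable (fun ω => ‖xstar - z k ω‖ ^ 2) := by
      simpa only [norm_sub_rev] using hiz k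
    obtain ⟨hcri, hcr0⟩ := alpc_cross (hle k) hwm (hintvh k) (hvhmean s t ht) hw2 (hintvhvar k)
    have hD := hintD s t ht
    rw [← hk] at hD
    have b1 := alpc_condbound (hle k) hD (hvvar s t ht)
    have b2 := alpc_condbound (hle k) hD (hdiffvar s t ht)
    rw [← hk] at b1 b2
    set D : Ω → ℝ := fun ω => F (xtil s ω) - F (x (k + 1) ω) -
        ⟪gF (x (k + 1) ω), xtil s ω - x (k + 1) ω⟫ with hDdef
    have hpt : ∀ ω, P (y (k + 1) ω) ≤ τ₁ * P xstar + τ₂ * P (xtil s ω)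
        + (1 - τ₁ - τ₂) * P (y k ω) + 1 / (6 * L) * ‖v (k + 1) ω - gF (x (k + 1) ω)‖ ^ 2
        + 1 / (4 * L) * ‖vh (k + 1) ω - v (k + 1) ω‖ ^ 2 - τ₂ * D ω
        + τ₁ * ⟪xstar - z k ω, vh (k + 1) ω - gF (x (k + 1) ω)⟫
        + κ * ‖z k ω - xstar‖ ^ 2 - κ * q * ‖z (k + 1) ω - xstar‖ ^ 2 := by
      intro ω
      simp only [hP]
      exact alpc_step hL hτ₁pos hτ₂pos.le (by linarith) hα hσ hgF hgFsm hFconv hstrong xstar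
        (hxcomb s t ht ω) (hyupdate k ω) (hzupdate k ω)
    have i0 : Integrable (fun _ : Ω => τ₁ * P xstar) := integrable_const _
    have i1 := (hintPxtil s).const_mul τ₂
    have i2 := (hintPy k).const_mul (1 - τ₁ - τ₂)
    have i3 := (hintvvar k).const_mul (1 / (6 * L))
    have i4 := (hintdiff k).const_mul (1 / (4 * L))
    have i5 := hD.const_mul τ₂
    have i6 := hcri.const_mul τ₁
    have i7 := (hiz k).const_mul κ
    have i8 := (hiz (k + 1)).const_mul (κ * q)
    have j1 := i0.add i1
    have j2 := j1.add i2
    have j3 := j2.add i3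
    have j4 := j3.add i4
    have j5 := j4.sub i5
    have j6 := j5.add i6
    have j7 := j6.add i7
    have j8 := j7.sub i8
    have hmono := integral_mono (hintPy (k + 1)) j8 hpt
    rw [integral_sub' j7 i8, integral_add' j6 i7, integral_add' j5 i6, integral_sub' j4 i5,
      integral_add' j3 i4, integral_add' j2 i3, integral_add' j1 i2, integral_add' i0 i1,
      integral_const_mul, integral_const_mul, integral_const_mul, integral_const_mul,
      integral_const_mul, integral_const_mul, integral_const_mul, integral_const_mul,
      hcr0] at hmono
    simp only [integral_const, probReal_univ, one_smul, mul_zero, add_zero,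
      integral_const_mul] at hmono
    have b1' := mul_le_mul_of_nonneg_left b1 (show 0 ≤ 1 / (6 * L) by positivity)
    have b2' := mul_le_mul_of_nonneg_left b2 (show 0 ≤ 1 / (4 * L) by positivity)
    have e1 : 1 / (6 * L) * (4 * L * ζ * ∫ ω, D ω) + 1 / (4 * L) *
        (4 * L * (ζ + 1 / (2 * (B : ℝ))) * ∫ ω, D ω) = τ₂ * ∫ ω, D ω := by
      rw [hτ₂]; field_simp; ring
    simp only [a, bb, c]
    linarith
  have hbb : ∀ s, Q * bb (s + 1) ≤ ∑ t ∈ Finset.range m, q ^ t * a (s * m + t + 1) := by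
    intro s
    have hpt : ∀ ω, P (xtil (s + 1) ω) ≤
        Q⁻¹ * ∑ t ∈ Finset.range m, q ^ t * P (y (s * m + t + 1) ω) := by
      intro ω
      rw [hxtilsucc s ω, Finset.smul_sum, Finset.mul_sum]
      have := hPconv.map_sum_le (t := Finset.range m) (w := fun t => Q⁻¹ * q ^ t)
        (p := fun t => y (s * m + t + 1) ω) (fun t _ => by positivity)
        (by rw [← Finset.mul_sum, ← hQ]; field_simp) (by simp)
      simpa only [smul_eq_mul, mul_smul, mul_assoc] using this
    have hint : Integrable fun ω => ∑ t ∈ Finset.range m, q ^ t * P (y (s * m + t + 1) ω) :=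
      integrable_finsetSum _ fun t _ => (hintPy _).const_mul _
    have h1 := integral_mono (hintPxtil (s + 1)) (hint.const_mul Q⁻¹) hpt
    rw [integral_const_mul, integral_finsetSum _ fun t _ => (hintPy _).const_mul _] at h1
    simp only [integral_const_mul] at h1
    have h2 := mul_le_mul_of_nonneg_left h1 hQpos.le
    rw [mul_inv_cancel_left₀ hQpos.ne'] at h2
    simp only [a, bb, mul_sub, Finset.sum_sub_distrib, ← Finset.sum_mul]
    rw [← hQ]
    linarith
  have hgeom : τ₂ * q ^ m ≤ 1 - (1 - τ₁ - τ₂) * q := by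
    have := alpc_geom hm hepos (by rw [hme]; exact hτ₁le) hτ₂pos.le hτ₂le
    rwa [hme] at this
  have hmain := alpc_rec hqpos hann hgeom hτ₂pos.le hstep hbb
  -- conclusion
  have hβ : 0 ≤ 1 - τ₁ - τ₂ := by linarith
  set R : ℝ := P x0 - P xstar with hR
  have hdist : ‖x0 - xstar‖ ^ 2 ≤ 2 / σ * R := by
    have := alpc_strong_min hFconv hstrong (p := xstar) (fun y => by simpa [hP] using hstar y) x0
    rw [← hP, ← hP] at this
    have h1 : σ / 2 * ‖x0 - xstar‖ ^ 2 ≤ R := by linarith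
    calc ‖x0 - xstar‖ ^ 2 = 2 / σ * (σ / 2 * ‖x0 - xstar‖ ^ 2) := by field_simp
      _ ≤ 2 / σ * R := by gcongr
  have ha0 : a 0 = R := by simp [a, hy0, hR]
  have hb0 : bb 0 = R := by simp [bb, hxtil0, hR]
  have hc0 : c 0 ≤ κ * (2 / σ * R) := by
    simp only [c, hz0]
    simp only [integral_const, probReal_univ, one_smul]
    gcongr
  refine ⟨(τ₂ * Q + (1 - τ₁ - τ₂) + κ * (2 / σ)) / (τ₂ * Q), by positivity, fun S => ?_⟩
  rw [hesqrt, ← hq]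
  have hS := hmain S
  rw [ha0, hb0, ← hQ] at hS
  have hpow : 0 < q ^ (S * m) := by positivity
  have h1 : q ^ (S * m) * (τ₂ * Q * bb S) ≤ (τ₂ * Q + (1 - τ₁ - τ₂) + κ * (2 / σ)) * R := by
    have h2 : q ^ (S * m) * (τ₂ * Q * bb S) ≤
        q ^ (S * m) * (τ₂ * Q * bb S + (1 - τ₁ - τ₂) * a (S * m) + c (S * m)) := by
      apply mul_le_mul_of_nonneg_left _ hpow.le
      have := mul_nonneg hβ (hann (S * m))
      have := hcnn (S * m)
      linarith
    linarith
  have h3 : bb S ≤ ((τ₂ * Q + (1 - τ₁ - τ₂) + κ * (2 / σ)) * R) / (q ^ (S * m) * (τ₂ * Q)) := by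
    rw [le_div_iff₀ (by positivity)]
    linarith
  refine h3.trans (le_of_eq ?_)
  field_simp
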